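/- Let Assumption S* hold and let Assumption B̲_{{α_n}} hold for a sequence α_n ↑ 1. Define u(x) := liminf_{n→∞} u_{α_n}(x) for x ∈ X. Then there exists a deterministic policy φ satisfying the WACOI with this function u; consequently φ is average-cost optimal. -/

import Mathlib

open MeasureTheory ProbabilityTheory Filter Topology Set
open scoped ENNReal NNReal

noncomputable section

/-- The nonnegative part of an extended real, as an element of `ℝ≥0∞`. -/
def eToENN (x : EReal) : ℝ≥0∞ := if x = ⊤ then ⊤ else ENNReal.ofReal x.toReal

/-- Extended integral of an `EReal`-valued function: positive part minus negative part. -/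
def eInt {Y : Type*} [MeasurableSpace Y] (μ : Measure Y) (f : Y → EReal) : EReal :=
  ((∫⁻ y, eToENN (f y) ∂μ : ℝ≥0∞) : EReal) - ((∫⁻ y, eToENN (-(f y)) ∂μ : ℝ≥0∞) : EReal)

/-- Extended sum of an `EReal`-valued series: positive part minus negative part. -/
def eSum (f : ℕ → EReal) : EReal :=
  ((∑' t, eToENN (f t) : ℝ≥0∞) : EReal) - ((∑' t, eToENN (-(f t)) : ℝ≥0∞) : EReal)

/-- Histories of length `t`: `(X × A) ^ t × X`. -/
abbrev Hist (X A : Type*) (t : ℕ) := (Fin t → X × A) × X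

/-- A (randomized, history-dependent) policy: a regular transition probability from
histories to actions, at every time epoch. -/
structure Policy (X A : Type*) [MeasurableSpace X] [MeasurableSpace A] where
  π : ∀ t : ℕ, Kernel (Hist X A t) A
  markov : ∀ t, IsMarkovKernel (π t)

/-- A Markov decision process with state space `X`, action space `A`, one-step cost `c`
(measurable and bounded below, with values in `(-∞, +∞]`) and transition probability `q`. -/
structure MDP (X A : Type*) [MeasurableSpace X] [MeasurableSpace A] where
  c : X → A → EReal
  q : Kernel (X × A) X
  markov : IsMarkovKernel q
  c_meas : Measurable fun p : X × A => c p.1 p.2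
  c_ne_bot : ∃ K : ℝ, ∀ x a, (K : EReal) ≤ c x a

variable {X A : Type*} [MeasurableSpace X] [MeasurableSpace A]

/-- The deterministic policy given by a measurable map `φ : X → A` applied to the current state. -/
def detPolicy (φ : X → A) (hφ : Measurable φ) : Policy X A :=
  ⟨fun t => Kernel.deterministic (fun h : Hist X A t => φ h.2) (hφ.comp measurable_snd),
   fun _ => by infer_instance⟩

/-- The distribution `P_x^π` of the history `h_t`, constructed recursively
(Ionescu-Tulcea finite-dimensional marginals). -/
def histMeas (M : MDP X A) (p : Policy X A) (x : X) : ∀ t : ℕ, Measure (Hist X A t)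
  | 0 => Measure.dirac (Fin.elim0, x)
  | (t + 1) =>
      (histMeas M p x t).bind fun h =>
        ((p.π t) h).bind fun a =>
          (M.q (h.2, a)).map fun x' => (Fin.snoc h.1 (h.2, a), x')

/-- The joint distribution of the state-action pair `(x_t, a_t)` under `P_x^π`. -/
def saMeas (M : MDP X A) (p : Policy X A) (x : X) (t : ℕ) : Measure (X × A) :=
  (histMeas M p x t).bind fun h => ((p.π t) h).map fun a => (h.2, a)

/-- `E_x^π c(x_t, a_t)`. -/
def expCost (M : MDP X A) (p : Policy X A) (x : X) (t : ℕ) : EReal :=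
  eInt (saMeas M p x t) fun sa => M.c sa.1 sa.2

/-- The expected total discounted cost `v_α^π(x) = E_x^π ∑_t α^t c(x_t, a_t)`. -/
def vDisc (M : MDP X A) (α : ℝ) (p : Policy X A) (x : X) : EReal :=
  eSum fun t => ((α ^ t : ℝ) : EReal) * expCost M p x t

/-- The finite-horizon expected total (undiscounted) cost `v_{N,1}^π(x)`. -/
def vFin (M : MDP X A) (N : ℕ) (p : Policy X A) (x : X) : EReal :=
  ∑ t ∈ Finset.range N, expCost M p x t

/-- The discounted value function `v_α(x) = inf_π v_α^π(x)`. -/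
def vDiscOpt (M : MDP X A) (α : ℝ) (x : X) : EReal :=
  ⨅ p : Policy X A, vDisc M α p x

/-- The average cost per unit time `w^π(x)`. -/
def avgCost (M : MDP X A) (p : Policy X A) (x : X) : EReal :=
  Filter.limsup (fun N : ℕ => (((N : ℝ)⁻¹ : ℝ) : EReal) * vFin M N p x) atTop

/-- The optimal average cost `w(x) = inf_π w^π(x)`. -/
def avgOpt (M : MDP X A) (x : X) : EReal :=
  ⨅ p : Policy X A, avgCost M p x

/-- `w* = inf_x w(x)`. -/
def wStar (M : MDP X A) : EReal := ⨅ x : X, avgOpt M x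

/-- `m_α = inf_x v_α(x)`. -/
def mDisc (M : MDP X A) (α : ℝ) : EReal := ⨅ x : X, vDiscOpt M α x

/-- The discounted relative value function `u_α(x) = v_α(x) - m_α`. -/
def uDisc (M : MDP X A) (α : ℝ) (x : X) : EReal := vDiscOpt M α x - mDisc M α

/-- `w̄ = limsup_{α↑1} (1-α) m_α`. -/
def wBar (M : MDP X A) : EReal :=
  Filter.limsup (fun α : ℝ => ((1 - α : ℝ) : EReal) * mDisc M α) (𝓝[Set.Ico (0:ℝ) 1] 1)

/-- `w̲ = liminf_{α↑1} (1-α) m_α`. -/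
def wLow (M : MDP X A) : EReal :=
  Filter.liminf (fun α : ℝ => ((1 - α : ℝ) : EReal) * mDisc M α) (𝓝[Set.Ico (0:ℝ) 1] 1)

/-- `w̄_{{α_n}} = limsup_n (1-α_n) m_{α_n}`. -/
def wBarSeq (M : MDP X A) (a : ℕ → ℝ) : EReal :=
  Filter.limsup (fun n : ℕ => ((1 - a n : ℝ) : EReal) * mDisc M (a n)) atTop

/-- `w̲_{{α_n}} = liminf_n (1-α_n) m_{α_n}`. -/
def wLowSeq (M : MDP X A) (a : ℕ → ℝ) : EReal :=
  Filter.liminf (fun n : ℕ => ((1 - a n : ℝ) : EReal) * mDisc M (a n)) atTop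


section TopologicalAssumptions

variable {X A : Type*} [MetricSpace X] [TopologicalSpace.SeparableSpace X]
  [MeasurableSpace X] [BorelSpace X] [StandardBorelSpace X]
  [MetricSpace A] [TopologicalSpace.SeparableSpace A]
  [MeasurableSpace A] [BorelSpace A] [StandardBorelSpace A]

/-- Assumption W*(i): the cost `c` is `K`-inf-compact, i.e., for every nonempty compact
`K ⊆ X`, the restriction of `c` to `K × A` has compact sublevel sets. -/
def AssumptionWi (M : MDP X A) : Prop :=
  ∀ K : Set X, K.Nonempty → IsCompact K →
    ∀ lam : ℝ, IsCompact {p : X × A | p.1 ∈ K ∧ M.c p.1 p.2 ≤ (lam : EReal)}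

/-- Assumption W*(ii): the transition probability `q(·|x,a)` is weakly continuous in `(x,a)`. -/
def AssumptionWii (M : MDP X A) : Prop :=
  ∀ f : BoundedContinuousFunction X ℝ, Continuous fun p : X × A => ∫ y, f y ∂ (M.q p)

/-- Assumption S*(i): for each `x`, the function `a ↦ c(x,a)` has compact sublevel sets. -/
def AssumptionSi (M : MDP X A) : Prop :=
  ∀ x : X, ∀ lam : ℝ, IsCompact {a : A | M.c x a ≤ (lam : EReal)}

/-- Assumption S*(ii): for each `x`, the transition probability `q(·|x,a)` is setwise
continuous in `a`. -/
def AssumptionSii (M : MDP X A) : Prop :=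
  ∀ x : X, ∀ B : Set X, MeasurableSet B → Continuous fun a : A => M.q (x, a) B

end TopologicalAssumptions

section Statements

variable {X A : Type*} [MetricSpace X] [TopologicalSpace.SeparableSpace X]
  [MeasurableSpace X] [BorelSpace X] [StandardBorelSpace X]
  [MetricSpace A] [TopologicalSpace.SeparableSpace A]
  [MeasurableSpace A] [BorelSpace A] [StandardBorelSpace A]

/-- The pointwise lower limit `u(x) = liminf_{n→∞} u_{α_n}(x)`. -/
def uPointwise (M : MDP X A) (a : ℕ → ℝ) (x : X) : EReal :=
  Filter.liminf (fun n : ℕ => uDisc M (a n) x) atTop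

end Statements


section Novikov

variable {Y : Type*} [MeasurableSpace Y]

/-- A sequence of sets can be enlarged to measurable sets with empty intersection. -/
def SeqSeparable (s : ℕ → Set Y) : Prop :=
  ∃ t : ℕ → Set Y, (∀ n, MeasurableSet (t n)) ∧ (∀ n, s n ⊆ t n) ∧ ⋂ n, t n = ∅

lemma SeqSeparable.of_subset_iUnion {s : ℕ → Set Y} (k : ℕ) (d : ℕ → ℕ → Set Y)
    (hd : ∀ m, SeqSeparable (d m)) (hk : s k ⊆ ⋃ m, d m k)
    (hne : ∀ j, j ≠ k → ∀ m, s j ⊆ d m j) : SeqSeparable s := by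
  choose t ht hst hemp using hd
  refine ⟨fun j => if j = k then ⋃ m, t m k else ⋂ m, t m j, fun j => ?_, fun j => ?_, ?_⟩
  · dsimp only
    split_ifs
    · exact MeasurableSet.iUnion fun m => ht m k
    · exact MeasurableSet.iInter fun m => ht m j
  · dsimp only
    split_ifs with h
    · subst h
      exact hk.trans (iUnion_mono fun m => hst m j)
    · exact subset_iInter fun m => (hne j h m).trans (hst m j)
  · rw [eq_empty_iff_forall_notMem]
    intro y hy
    rw [mem_iInter] at hy
    have hyk := hy k
    simp only [if_true, mem_iUnion] at hyk
    obtain ⟨m, hm⟩ := hyk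
    have : y ∈ ⋂ j, t m j := by
      rw [mem_iInter]
      intro j
      by_cases h : j = k
      · exact h ▸ hm
      · have := hy j
        simp only [h, if_false, mem_iInter] at this
        exact this m
    rw [hemp m] at this
    exact this

lemma exists_sequence_of_extension {P : (ℕ → ℕ) → ℕ → Prop}
    (hP : ∀ w w' N, w' ∈ PiNat.cylinder w N → P w N → P w' N)
    (w₀ : ℕ → ℕ) (h0 : P w₀ 0)
    (hstep : ∀ N w, P w N → ∃ w' ∈ PiNat.cylinder w N, P w' (N + 1)) :
    ∃ w, ∀ N, P w N := by
  choose! F hFc hFP using hstep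
  let p : ℕ → ℕ → ℕ := fun n => Nat.rec w₀ (fun N w => F N w) n
  have hp : ∀ n, P (p n) n := by
    intro n
    induction n with
    | zero => exact h0
    | succ n ih => exact hFP n (p n) ih
  have hst : ∀ m n, m + 1 ≤ n → p n m = p (m + 1) m := by
    intro m
    apply Nat.le_induction
    · rfl
    · intro n hmn ih
      rw [← ih]
      exact hFc n (p n) (hp n) m hmn
  refine ⟨fun m => p (m + 1) m, fun N => hP (p N) _ N (fun i hi => ?_) (hp N)⟩
  exact (hst i N hi).symm

/-- Novikov's separation theorem: analytic sets with empty intersection can be enlarged to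
measurable sets with empty intersection. -/
theorem seqSeparable_of_analyticSet [TopologicalSpace Y] [T2Space Y] [OpensMeasurableSpace Y]
    {s : ℕ → Set Y} (hs : ∀ n, AnalyticSet (s n)) (hemp : ⋂ n, s n = ∅) : SeqSeparable s := by
  by_cases hE : ∃ n, s n = ∅
  · obtain ⟨n, hn⟩ := hE
    refine ⟨fun j => if j = n then ∅ else univ, fun j => ?_, fun j => ?_, ?_⟩
    · dsimp only; split_ifs <;> simp
    · dsimp only; split_ifs with h
      · rw [h, hn]
      · exact subset_univ _
    · exact eq_empty_of_subset_empty ((iInter_subset _ n).trans (by simp))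
  push Not at hE
  have hf : ∀ n, ∃ f : (ℕ → ℕ) → Y, Continuous f ∧ range f = s n := fun n => by
    rcases (by simpa only [AnalyticSet] using hs n : s n = ∅ ∨ _) with h | h
    · exact absurd h (hE n).ne_empty
    · exact h
  choose f hfc hfr using hf
  by_contra hsep
  let D : (ℕ → ℕ) → ℕ → ℕ → Set Y := fun w N k =>
    f k '' {x | ∀ j, Nat.pair k j < N → x j = w (Nat.pair k j)}
  obtain ⟨w, hw⟩ : ∃ w, ∀ N, ¬ SeqSeparable (D w N) := by
    refine exists_sequence_of_extension (P := fun w N => ¬ SeqSeparable (D w N)) ?_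
      (fun _ => 0) ?_ ?_
    · intro w w' N hw' h
      convert h using 2
      funext k
      refine congrArg (f k '' ·) (Set.ext fun x => forall_congr' fun j => ?_)
      refine forall_congr' fun hj => ?_
      rw [hw' _ hj]
    · convert hsep using 2
      funext k
      simp [D, hfr]
    · intro N w
      contrapose!
      intro H
      set k := (Nat.unpair N).1 with hk
      set j₀ := (Nat.unpair N).2 with hj
      have hN : Nat.pair k j₀ = N := Nat.pair_unpair N
      refine SeqSeparable.of_subset_iUnion k
        (fun m => D (Function.update w N m) (N + 1))
        (fun m => H _ (PiNat.update_mem_cylinder _ _ _)) ?_ ?_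
      · rintro _ ⟨x, hx, rfl⟩
        refine mem_iUnion.2 ⟨x j₀, x, fun j hj => ?_, rfl⟩
        rcases Nat.lt_succ_iff_lt_or_eq.1 hj with h | h
        · rw [Function.update_of_ne h.ne]
          exact hx j h
        · have : j = j₀ := (Nat.pair_eq_pair.1 (h.trans hN.symm)).2
          rw [h, Function.update_self, this]
      · rintro i hi m _ ⟨x, hx, rfl⟩
        refine ⟨x, fun j hj => ?_, rfl⟩
        have hne : Nat.pair i j ≠ N := fun h => hi (Nat.pair_eq_pair.1 (h.trans hN.symm)).1
        rw [Function.update_of_ne hne]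
        exact hx j (lt_of_le_of_ne (Nat.lt_succ_iff.1 hj) hne)
  let x : ℕ → ℕ → ℕ := fun k j => w (Nat.pair k j)
  have hnhd : ∀ k U, IsOpen U → f k (x k) ∈ U → ∃ N₀, ∀ N ≥ N₀, D w N k ⊆ U := by
    intro k U hU hx
    have hpre : f k ⁻¹' U ∈ 𝓝 (x k) := (hfc k).continuousAt.preimage_mem_nhds (hU.mem_nhds hx)
    obtain ⟨n, hn⟩ : ∃ n, PiNat.cylinder (x k) n ⊆ f k ⁻¹' U := by
      obtain ⟨_, ⟨y, n, rfl⟩, hxy, hsub⟩ :=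
        (PiNat.isTopologicalBasis_cylinders (fun _ : ℕ => ℕ)).mem_nhds_iff.1 hpre
      exact ⟨n, by rwa [← PiNat.mem_cylinder_iff_eq.1 hxy] at hsub⟩
    refine ⟨Nat.pair k n, fun N hN => ?_⟩
    rintro _ ⟨y, hy, rfl⟩
    exact hn fun j hj => hy j ((Nat.pair_lt_pair_right k hj).trans_le hN)
  have hex : ∃ k, f 0 (x 0) ≠ f k (x k) := by
    by_contra! h
    have : f 0 (x 0) ∈ ⋂ n, s n := mem_iInter.2 fun k => by
      rw [h k, ← hfr k]
      exact mem_range_self _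
    rw [hemp] at this
    exact this
  obtain ⟨k, hk⟩ := hex
  obtain ⟨U, V, hU, hV, hxU, hxV, hUV⟩ := t2_separation hk
  obtain ⟨N₁, h₁⟩ := hnhd 0 U hU hxU
  obtain ⟨N₂, h₂⟩ := hnhd k V hV hxV
  have hk0 : k ≠ 0 := fun h => hk (by rw [h])
  refine hw (max N₁ N₂) ⟨fun j => if j = 0 then U else if j = k then V else univ,
    fun j => ?_, fun j => ?_, ?_⟩
  · dsimp only; split_ifs
    exacts [hU.measurableSet, hV.measurableSet, MeasurableSet.univ]
  · dsimp only; split_ifs with h h'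
    · rw [h]; exact h₁ _ (le_max_left _ _)
    · rw [h']; exact h₂ _ (le_max_right _ _)
    · exact subset_univ _
  · rw [eq_empty_iff_forall_notMem]
    intro y hy
    rw [mem_iInter] at hy
    have a := hy 0
    have b := hy k
    simp only [if_true, hk0, if_false] at a b
    exact disjoint_left.1 hUV a b

end Novikov

lemma MeasureTheory.AnalyticSet.inter {T : Type*} [TopologicalSpace T] [T2Space T] {s t : Set T}
    (hs : AnalyticSet s) (ht : AnalyticSet t) : AnalyticSet (s ∩ t) := by
  rw [inter_eq_iInter]
  exact AnalyticSet.iInter fun b => by cases b <;> assumption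

lemma MeasureTheory.AnalyticSet.union {T : Type*} [TopologicalSpace T] {s t : Set T}
    (hs : AnalyticSet s) (ht : AnalyticSet t) : AnalyticSet (s ∪ t) := by
  rw [union_eq_iUnion]
  exact AnalyticSet.iUnion fun b => by cases b <;> assumption

section CompactSections

variable {S : Type*} [MeasurableSpace S]

lemma measurableSet_fst_image_of_isClosed_sections
    {K : Type*} [StandardBorelSpace S] [TopologicalSpace K] [CompactSpace K] [PolishSpace K]
    [MeasurableSpace K] [BorelSpace K] {B : Set (S × K)} (hB : MeasurableSet B)
    (hc : ∀ x, IsClosed {a | (x, a) ∈ B}) : MeasurableSet (Prod.fst '' B) := by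
  let := upgradeStandardBorel S
  obtain ⟨V, hV⟩ : ∃ V : ℕ → Set K, TopologicalSpace.IsTopologicalBasis (range V) := by
    obtain ⟨b, hb, -, hbas⟩ := TopologicalSpace.exists_countable_basis K
    by_cases hne : b.Nonempty
    · obtain ⟨V, rfl⟩ := hb.exists_eq_range hne
      exact ⟨V, hbas⟩
    · rw [not_nonempty_iff_eq_empty] at hne
      refine ⟨fun _ => ∅, ?_⟩
      rw [range_const, ← insert_empty_eq, ← hne]
      exact hbas.insert_empty
  have hVo : ∀ n, IsOpen (V n) := fun n => hV.isOpen (mem_range_self n)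
  let P : ℕ → Set S := fun n => Prod.fst '' (B ∩ (Prod.snd ⁻¹' V n))
  have hPm : ∀ n, MeasurableSet (B ∩ (Prod.snd ⁻¹' V n)) := fun n =>
    hB.inter (measurable_snd (hVo n).measurableSet)
  have hP : ∀ n, AnalyticSet (P n) := fun n =>
    (hPm n).analyticSet.image_of_continuous continuous_fst
  have hPA : ∀ n, AnalyticSet (Prod.fst ⁻¹' P n : Set (S × K)) := fun n =>
    (hP n).preimage continuous_fst
  have hS : ∀ n, AnalyticSet (Bᶜ ∩ (Prod.fst ⁻¹' P n ∪ Prod.snd ⁻¹' (V n)ᶜ) : Set (S × K)) := by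
    intro n
    refine AnalyticSet.inter hB.compl.analyticSet (AnalyticSet.union (hPA n) ?_)
    exact (measurable_snd (hVo n).measurableSet.compl).analyticSet
  obtain ⟨T, hTm, hST, hTe⟩ := seqSeparable_of_analyticSet hS (by
    rw [eq_empty_iff_forall_notMem]
    rintro ⟨x, a⟩ h
    rw [mem_iInter] at h
    have hxa : a ∈ {a | (x, a) ∈ B}ᶜ := (h 0).1
    obtain ⟨_, ⟨n, rfl⟩, han, hn⟩ := hV.exists_subset_of_mem_open hxa (hc x).isOpen_compl
    rcases (h n).2 with ⟨⟨x', a'⟩, ⟨h1, h2⟩, rfl⟩ | h'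
    · exact hn h2 h1
    · exact h' han)
  have hsepn : ∀ n, MeasurablySeparable (Prod.fst '' (Bᶜ \ T n)) (P n) := by
    intro n
    refine AnalyticSet.measurablySeparable
      ((hB.compl.diff (hTm n)).analyticSet.image_of_continuous continuous_fst) (hP n) ?_
    rw [disjoint_left]
    rintro _ ⟨⟨x, a⟩, ⟨hxB, hxT⟩, rfl⟩ hx
    exact hxT (hST n ⟨hxB, Or.inl hx⟩)
  choose E hE hEP hEm using hsepn
  have hcompl : (Prod.fst '' B)ᶜ =
      ⋃ F : Finset ℕ, {x | (⋃ n ∈ F, V n) = univ ∧ ∀ n ∈ F, x ∈ E n} := by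
    ext x
    simp only [mem_compl_iff, mem_iUnion, mem_ofPred_eq]
    constructor
    · intro hx
      have hcov : (univ : Set K) ⊆ ⋃ n : {n // x ∈ E n}, V n.1 := by
        intro a _
        have hxa : (x, a) ∉ B := fun h => hx ⟨_, h, rfl⟩
        have : (x, a) ∉ ⋂ n, T n := by rw [hTe]; exact notMem_empty _
        rw [mem_iInter] at this
        push Not at this
        obtain ⟨n, hn⟩ := this
        refine mem_iUnion.2 ⟨⟨n, hE n ⟨_, ⟨hxa, hn⟩, rfl⟩⟩, ?_⟩
        by_contra haV
        exact hn (hST n ⟨hxa, Or.inr haV⟩)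
      obtain ⟨F, hF⟩ := isCompact_univ.elim_finite_subcover _
        (fun n : {n // x ∈ E n} => hVo n.1) hcov
      refine ⟨F.map (Function.Embedding.subtype _), ?_, ?_⟩
      · refine eq_univ_of_univ_subset (hF.trans ?_)
        refine iUnion₂_subset fun n hn => ?_
        exact subset_biUnion_of_mem (u := fun n => V n)
          (show n.1 ∈ (F.map (Function.Embedding.subtype _) : Finset ℕ) by
            exact Finset.mem_map_of_mem (Function.Embedding.subtype _) hn)
      · intro n hn
        obtain ⟨m, -, rfl⟩ := Finset.mem_map.1 hn
        exact m.2
    · rintro ⟨F, hF, hxE⟩ ⟨⟨x', a⟩, hxa, rfl⟩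
      have : a ∈ ⋃ n ∈ F, V n := hF ▸ mem_univ a
      obtain ⟨n, hn, han⟩ := mem_iUnion₂.1 this
      exact disjoint_left.1 (hEP n) ⟨_, ⟨hxa, han⟩, rfl⟩ (hxE n hn)
  rw [← MeasurableSet.compl_iff, hcompl]
  refine MeasurableSet.iUnion fun F => ?_
  by_cases hF : (⋃ n ∈ F, V n) = univ
  · simp only [hF, true_and, ofPred_forall]
    exact MeasurableSet.biInter F.countable_toSet fun n _ => hEm n
  · simp [hF]

variable {T : Type*} [TopologicalSpace T] [TopologicalSpace.MetrizableSpace T]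
  [SecondCountableTopology T] [MeasurableSpace T] [BorelSpace T] [StandardBorelSpace T]

variable (T) in
lemma exists_continuous_measurableEmbedding_cube :
    ∃ F : T → ℕ → unitInterval, Continuous F ∧ MeasurableEmbedding F := by
  let := TopologicalSpace.metrizableSpaceMetric T
  obtain ⟨F, hF⟩ := Metric.PiNatEmbed.exists_embedding_to_hilbert_cube (X := T)
  exact ⟨F, hF.continuous, hF.continuous.measurable.measurableEmbedding hF.injective⟩

/-- The projection of a Borel set with compact sections is Borel. -/
theorem measurableSet_fst_image_of_isCompact_sections [StandardBorelSpace S]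
    {B : Set (S × T)} (hB : MeasurableSet B) (hc : ∀ x, IsCompact {a | (x, a) ∈ B}) :
    MeasurableSet (Prod.fst '' B) := by
  obtain ⟨F, hF, hFm⟩ := exists_continuous_measurableEmbedding_cube T
  have hG : MeasurableEmbedding (Prod.map id F : S × T → S × (ℕ → unitInterval)) :=
    MeasurableEmbedding.id.prodMap hFm
  have := measurableSet_fst_image_of_isClosed_sections (hG.measurableSet_image.2 hB)
    (fun x => by
      have : {a | (x, a) ∈ Prod.map id F '' B} = F '' {a | (x, a) ∈ B} := by
        ext k
        simp
      rw [this]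
      exact ((hc x).image hF).isClosed)
  rwa [image_image] at this

lemma exists_argmin_refinement [StandardBorelSpace S]
    {B : Set (S × T)} (hB : MeasurableSet B) (hc : ∀ x, IsCompact {a | (x, a) ∈ B})
    (hne : ∀ x, {a | (x, a) ∈ B}.Nonempty) {f : T → ℝ} (hf : Continuous f) :
    ∃ B' ⊆ B, (MeasurableSet B' ∧ (∀ x, IsCompact {a | (x, a) ∈ B'}) ∧
      ∀ x, {a | (x, a) ∈ B'}.Nonempty) ∧
      ∃ g : S → ℝ, Measurable g ∧ ∀ p ∈ B', f p.2 = g p.1 := by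
  choose m hm hmin using fun x => (hc x).exists_isMinOn (hne x) hf.continuousOn
  have hg : Measurable fun x => f (m x) := by
    refine measurable_of_Iic fun r => ?_
    have : (fun x => f (m x)) ⁻¹' Iic r = Prod.fst '' (B ∩ {p | f p.2 ≤ r}) := by
      ext x
      constructor
      · intro hx
        exact ⟨(x, m x), ⟨hm x, hx⟩, rfl⟩
      · rintro ⟨⟨x, a⟩, ⟨hxa, har⟩, rfl⟩
        exact (isMinOn_iff.1 (hmin x) a hxa).trans har
    rw [this]
    refine measurableSet_fst_image_of_isCompact_sections
      (hB.inter (measurableSet_le (hf.measurable.comp measurable_snd) measurable_const))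
      fun x => (hc x).inter_right (isClosed_le hf continuous_const)
  refine ⟨B ∩ {p | f p.2 = f (m p.1)}, inter_subset_left, ⟨?_, fun x => ?_, fun x => ?_⟩,
    _, hg, fun p hp => hp.2⟩
  · exact hB.inter (measurableSet_eq_fun (hf.measurable.comp measurable_snd)
      (hg.comp measurable_fst))
  · exact (hc x).inter_right (isClosed_eq hf (continuous_const (y := f (m x))))
  · exact ⟨m x, hm x, rfl⟩

/-- A Borel set with nonempty compact sections has a measurable selector. -/
theorem exists_measurable_selector_of_isCompact_sections [StandardBorelSpace S]
    {B : Set (S × T)} (hB : MeasurableSet B) (hc : ∀ x, IsCompact {a | (x, a) ∈ B})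
    (hne : ∀ x, {a | (x, a) ∈ B}.Nonempty) :
    ∃ φ : S → T, Measurable φ ∧ ∀ x, (x, φ x) ∈ B := by
  obtain ⟨F, hF, hFm⟩ := exists_continuous_measurableEmbedding_cube T
  let G := {B : Set (S × T) // MeasurableSet B ∧ (∀ x, IsCompact {a | (x, a) ∈ B}) ∧
      ∀ x, {a | (x, a) ∈ B}.Nonempty}
  have hstep : ∀ (n : ℕ) (C : G), ∃ C' : G, C'.1 ⊆ C.1 ∧
      ∃ g : S → ℝ, Measurable g ∧ ∀ p ∈ C'.1, (F p.2 n : ℝ) = g p.1 := by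
    rintro n ⟨C, h1, h2, h3⟩
    obtain ⟨C', hsub, hC', g, hg⟩ := exists_argmin_refinement h1 h2 h3
      (f := fun a => (F a n : ℝ)) (by fun_prop)
    exact ⟨⟨C', hC'⟩, hsub, g, hg⟩
  choose N hNsub g hg hNg using hstep
  let C : ℕ → G := fun n => Nat.rec ⟨B, hB, hc, hne⟩ (fun n C => N n C) n
  have hint : ∀ x, (⋂ n, {a | (x, a) ∈ (C n).1}).Nonempty := fun x =>
    IsCompact.nonempty_iInter_of_sequence_nonempty_isCompact_isClosed _
      (fun n a ha => hNsub n (C n) ha) (fun n => (C n).2.2.2 x) ((C 0).2.2.1 x)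
      (fun n => ((C n).2.2.1 x).isClosed)
  choose φ hφ using hint
  simp only [mem_iInter] at hφ
  refine ⟨φ, ?_, fun x => hφ x 0⟩
  rw [← hFm.measurable_comp_iff]
  refine measurable_pi_iff.2 fun n => ?_
  refine (MeasurableEmbedding.subtype_coe measurableSet_Icc).measurable_comp_iff.1 ?_
  have : (fun x => (F (φ x) n : ℝ)) = g n (C n) :=
    funext fun x => hNg n (C n) _ (hφ x (n + 1))
  change Measurable fun x => (F (φ x) n : ℝ)
  rw [this]
  exact hg n (C n)

lemma exists_measurable_selector_le [StandardBorelSpace S] [Nonempty T]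
    {h : S × T → ℝ≥0∞} (hh : Measurable h)
    (hc : ∀ x r, r < ⊤ → IsCompact {a | h (x, a) ≤ r})
    {r : S → ℝ≥0∞} (hr : Measurable r) (hex : ∀ x, r x < ⊤ → ∃ a, h (x, a) ≤ r x) :
    ∃ φ : S → T, Measurable φ ∧ ∀ x, h (x, φ x) ≤ r x := by
  obtain ⟨a₀⟩ := ‹Nonempty T›
  let B : Set (S × T) := {p | r p.1 < ⊤ ∧ h p ≤ r p.1} ∪ {p | r p.1 = ⊤ ∧ p.2 = a₀}
  have hr1 : Measurable fun p : S × T => r p.1 := hr.comp measurable_fst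
  have hB : MeasurableSet B := by
    refine MeasurableSet.union ?_ ?_
    · exact (measurableSet_lt hr1 measurable_const).inter (measurableSet_le hh hr1)
    · exact (measurableSet_eq_fun hr1 measurable_const).inter
        (measurable_snd (measurableSet_singleton a₀))
  have hsec : ∀ x, {a | (x, a) ∈ B} = if r x < ⊤ then {a | h (x, a) ≤ r x} else {a₀} := by
    intro x
    ext a
    rcases lt_or_eq_of_le (le_top (a := r x)) with hx | hx
    · simp [B, hx, hx.ne]
    · simp [B, hx]
  obtain ⟨φ, hφ, hφB⟩ := exists_measurable_selector_of_isCompact_sections hB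
    (fun x => by
      rw [hsec]
      split_ifs with hx
      · exact hc x _ hx
      · exact isCompact_singleton)
    (fun x => by
      rw [hsec]
      split_ifs with hx
      · exact hex x hx
      · exact singleton_nonempty _)
  refine ⟨φ, hφ, fun x => ?_⟩
  rcases hφB x with hx | hx
  · exact hx.2
  · exact le_top.trans_eq (Eq.symm hx.1)

lemma measurable_iInf_of_isCompact_sublevel [StandardBorelSpace S]
    {h : S × T → ℝ≥0∞} (hh : Measurable h)
    (hc : ∀ x r, r < ⊤ → IsCompact {a | h (x, a) ≤ r}) :
    Measurable fun x => ⨅ a, h (x, a) := by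
  refine measurable_of_Iio fun r => ?_
  have : (fun x => ⨅ a, h (x, a)) ⁻¹' Iio r =
      ⋃ q : ℚ, {_x : S | (Real.toNNReal q : ℝ≥0∞) < r} ∩
        Prod.fst '' {p : S × T | h p ≤ (Real.toNNReal q : ℝ≥0∞)} := by
    ext x
    simp only [mem_preimage, mem_Iio, iInf_lt_iff, mem_iUnion]
    constructor
    · rintro ⟨a, ha⟩
      obtain ⟨q, -, h1, h2⟩ := ENNReal.lt_iff_exists_rat_btwn.1 ha
      exact ⟨q, h2, (x, a), h1.le, rfl⟩
    · rintro ⟨q, h1, ⟨x, a⟩, h2, rfl⟩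
      exact ⟨a, lt_of_le_of_lt h2 h1⟩
  rw [this]
  refine MeasurableSet.iUnion fun q => (MeasurableSet.const _).inter ?_
  exact measurableSet_fst_image_of_isCompact_sections (measurableSet_le hh measurable_const)
    fun x => hc x _ ENNReal.coe_lt_top

end CompactSections

section LowerSemicontinuity

lemma exists_forall_le_of_isCompact_sublevel {T : Type*} [TopologicalSpace T] {h : ℕ → T → ℝ≥0∞}
    (hmono : Monotone h) (hlsc : ∀ n, LowerSemicontinuous (h n))
    (hc : ∀ r, r < ⊤ → IsCompact {a | h 0 a ≤ r}) {R : ℝ≥0∞} (hR : R < ⊤)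
    (hex : ∀ n ε, 0 < ε → ∃ a, h n a ≤ R + ε) : ∃ a, ∀ n, h n a ≤ R := by
  have hcl : ∀ n r, IsClosed {a | h n a ≤ r} := fun n r => (hlsc n).isClosed_preimage r
  let ε : ℕ → ℝ≥0∞ := fun n => ((n : ℝ≥0∞) + 1)⁻¹
  have hε : ∀ n, 0 < ε n := fun n => ENNReal.inv_pos.2 (by finiteness)
  have hεt : Tendsto ε atTop (𝓝 0) := by
    have := (tendsto_add_atTop_iff_nat 1).2 ENNReal.tendsto_inv_nat_nhds_zero
    simpa [ε] using this
  have hεanti : Antitone ε := fun m n hmn => by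
    simp only [ε]
    gcongr
  have hε0 : ε 0 < ⊤ := by simp [ε]
  obtain ⟨a, ha⟩ := IsCompact.nonempty_iInter_of_sequence_nonempty_isCompact_isClosed
    (fun n => {a | h n a ≤ R + ε n})
    (fun n a ha => (hmono n.le_succ a).trans
      (le_trans ha (by gcongr; exact hεanti n.le_succ)))
    (fun n => hex n _ (hε n)) (hc _ (ENNReal.add_lt_top.2 ⟨hR, hε0⟩)) (fun n => hcl n _)
  rw [mem_iInter] at ha
  refine ⟨a, fun n => ?_⟩
  have hlim : Tendsto (fun k => R + ε k) atTop (𝓝 (R + 0)) := tendsto_const_nhds.add hεt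
  rw [add_zero] at hlim
  refine ge_of_tendsto hlim ?_
  filter_upwards [eventually_ge_atTop n] with k hk
  exact (hmono hk a).trans (ha k)

lemma lowerSemicontinuous_lintegral_of_setwise {S T : Type*} [MeasurableSpace S]
    [TopologicalSpace T] {ν : T → Measure S}
    (hν : ∀ B, MeasurableSet B → Continuous fun a => ν a B) {f : S → ℝ≥0∞} (hf : Measurable f) :
    LowerSemicontinuous fun a => ∫⁻ y, f y ∂ν a := by
  simp_rw [lintegral_eq_iSup_eapprox_lintegral hf]
  refine lowerSemicontinuous_iSup fun n => Continuous.lowerSemicontinuous ?_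
  simp only [SimpleFunc.lintegral]
  refine continuous_finsetSum _ fun r hr => ?_
  refine (ENNReal.continuous_const_mul ?_).comp (hν _ (SimpleFunc.measurableSet_preimage _ _))
  obtain ⟨y, rfl⟩ := SimpleFunc.mem_range.1 hr
  exact (SimpleFunc.eapprox_lt_top f n y).ne

end LowerSemicontinuity

section Histories

instance (p : Policy X A) (t : ℕ) : IsMarkovKernel (p.π t) := p.markov t

instance (M : MDP X A) : IsMarkovKernel M.q := M.markov

lemma measurable_map_kernel {α β γ : Type*} [MeasurableSpace α] [MeasurableSpace β]
    [MeasurableSpace γ] (κ : Kernel α β) [IsMarkovKernel κ] {g : α × β → γ} (hg : Measurable g) :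
    Measurable fun a => (κ a).map fun b => g (a, b) := by
  refine Measure.measurable_of_measurable_coe _ fun s hs => ?_
  have : ∀ a, ((κ a).map fun b => g (a, b)) s = κ a (Prod.mk a ⁻¹' (g ⁻¹' s)) := fun a =>
    Measure.map_apply (hg.comp measurable_prodMk_left) hs
  simp_rw [this]
  exact Kernel.measurable_kernel_prodMk_left (hg hs)

lemma measurable_bind_kernel {α β γ : Type*} [MeasurableSpace α] [MeasurableSpace β]
    [MeasurableSpace γ] (κ : Kernel α β) [IsMarkovKernel κ] {Φ : α × β → Measure γ}
    (hΦ : Measurable Φ) : Measurable fun a => (κ a).bind fun b => Φ (a, b) := by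
  refine Measure.measurable_of_measurable_coe _ fun s hs => ?_
  have : ∀ a, ((κ a).bind fun b => Φ (a, b)) s = ∫⁻ b, Φ (a, b) s ∂κ a := fun a =>
    Measure.bind_apply hs (hΦ.comp measurable_prodMk_left).aemeasurable
  simp_rw [this]
  exact Measurable.lintegral_kernel_prod_right (f := fun a b => Φ (a, b) s)
    ((Measure.measurable_coe hs).comp hΦ)

lemma measurable_finSnoc {β : Type*} [MeasurableSpace β] (t : ℕ) :
    Measurable fun z : (Fin t → β) × β => (Fin.snoc z.1 z.2 : Fin (t + 1) → β) := by
  refine measurable_pi_iff.2 fun i => ?_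
  induction i using Fin.lastCases with
  | last => simpa using measurable_snd
  | cast i => simpa using (measurable_pi_iff.1 measurable_fst i)

variable (M : MDP X A) (p : Policy X A) (x : X)

lemma measurable_stateAction (t : ℕ) :
    Measurable fun h : Hist X A t => ((p.π t) h).map fun a => (h.2, a) :=
  measurable_map_kernel (p.π t) (g := fun z : Hist X A t × A => (z.1.2, z.2)) (by fun_prop)

lemma measurable_transition (t : ℕ) :
    Measurable fun z : Hist X A t × A => (M.q (z.1.2, z.2)).map fun x' =>
      ((Fin.snoc z.1.1 (z.1.2, z.2), x') : Hist X A (t + 1)) := by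
  let κ : Kernel (Hist X A t × A) X := M.q.comap (fun z => (z.1.2, z.2)) (by fun_prop)
  have hsnoc : Measurable fun z : (Hist X A t × A) × X =>
      (Fin.snoc z.1.1.1 (z.1.1.2, z.1.2) : Fin (t + 1) → X × A) :=
    (measurable_finSnoc t).comp (f := fun z : (Hist X A t × A) × X => (z.1.1.1, (z.1.1.2, z.1.2)))
      (by fun_prop)
  exact measurable_map_kernel κ
    (g := fun z : (Hist X A t × A) × X =>
      ((Fin.snoc z.1.1.1 (z.1.1.2, z.1.2), z.2) : Hist X A (t + 1)))
    (hsnoc.prodMk measurable_snd)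

lemma lintegral_saMeas {f : X × A → ℝ≥0∞} (hf : Measurable f) (t : ℕ) :
    ∫⁻ z, f z ∂saMeas M p x t = ∫⁻ h, ∫⁻ a, f (h.2, a) ∂p.π t h ∂histMeas M p x t := by
  rw [saMeas, Measure.lintegral_bind (measurable_stateAction p t).aemeasurable hf.aemeasurable]
  refine lintegral_congr fun h => ?_
  rw [lintegral_map hf measurable_prodMk_left]

lemma lintegral_histMeas_succ {f : X → ℝ≥0∞} (hf : Measurable f) (t : ℕ) :
    ∫⁻ h, f h.2 ∂histMeas M p x (t + 1) = ∫⁻ z, ∫⁻ y, f y ∂M.q z ∂saMeas M p x t := by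
  have hf2 : Measurable fun h : Hist X A (t + 1) => f h.2 := hf.comp measurable_snd
  rw [lintegral_saMeas M p x hf.lintegral_kernel, histMeas, Measure.lintegral_bind
    (measurable_bind_kernel (p.π t) (measurable_transition M t)).aemeasurable hf2.aemeasurable]
  refine lintegral_congr fun h => ?_
  refine (Measure.lintegral_bind
    ((measurable_transition M t).comp measurable_prodMk_left).aemeasurable
      hf2.aemeasurable).trans (lintegral_congr fun a => ?_)
  exact lintegral_map hf2 measurable_prodMk_left

instance isProbabilityMeasure_histMeas (t : ℕ) : IsProbabilityMeasure (histMeas M p x t) := by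
  induction t with
  | zero => rw [histMeas]; infer_instance
  | succ t ih =>
    have h := lintegral_histMeas_succ M p x (f := 1) measurable_one t
    rw [lintegral_saMeas M p x measurable_one.lintegral_kernel] at h
    exact ⟨by simpa using h⟩

instance isProbabilityMeasure_saMeas (t : ℕ) : IsProbabilityMeasure (saMeas M p x t) := by
  have h := lintegral_saMeas M p x (f := 1) measurable_one t
  exact ⟨by simpa using h⟩

lemma lintegral_saMeas_detPolicy {φ : X → A} (hφ : Measurable φ) {f : X × A → ℝ≥0∞}
    (hf : Measurable f) (t : ℕ) :
    ∫⁻ z, f z ∂saMeas M (detPolicy φ hφ) x t =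
      ∫⁻ h, f (h.2, φ h.2) ∂histMeas M (detPolicy φ hφ) x t := by
  rw [lintegral_saMeas M _ x hf]
  refine lintegral_congr fun h => ?_
  exact Kernel.lintegral_deterministic' (hφ.comp measurable_snd)
    (hf.comp measurable_prodMk_left)

lemma lintegral_histMeas_zero {f : X → ℝ≥0∞} (hf : Measurable f) :
    ∫⁻ h, f h.2 ∂histMeas M p x 0 = f x := by
  rw [histMeas]
  exact lintegral_dirac' _ (hf.comp measurable_snd)

end Histories

section DynamicProgramming

variable (M : MDP X A) {g : X × A → ℝ≥0∞}

/-- Total discounted expected value of the nonnegative cost `g`. -/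
def nnDisc (M : MDP X A) (g : X × A → ℝ≥0∞) (α : ℝ≥0∞) (p : Policy X A) (x : X) : ℝ≥0∞ :=
  ∑' t, α ^ t * ∫⁻ z, g z ∂saMeas M p x t

/-- Optimal total discounted expected value of the nonnegative cost `g`. -/
def nnDiscOpt (M : MDP X A) (g : X × A → ℝ≥0∞) (α : ℝ≥0∞) (x : X) : ℝ≥0∞ :=
  ⨅ p : Policy X A, nnDisc M g α p x

lemma lintegral_le_sum_of_le {α : ℝ≥0∞} (hg : Measurable g) {v : ℕ → X → ℝ≥0∞}
    (hv : ∀ n, Measurable (v n)) (h0 : ∀ x, v 0 x = 0)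
    (hle : ∀ n x a, v (n + 1) x ≤ g (x, a) + α * ∫⁻ y, v n y ∂M.q (x, a))
    (p : Policy X A) (x : X) (n s : ℕ) :
    ∫⁻ h, v n h.2 ∂histMeas M p x s ≤
      ∑ t ∈ Finset.range n, α ^ t * ∫⁻ z, g z ∂saMeas M p x (s + t) := by
  induction n generalizing s with
  | zero => simp [h0]
  | succ n ih =>
    have hq : Measurable fun z => ∫⁻ y, v n y ∂M.q z := (hv n).lintegral_kernel
    calc ∫⁻ h, v (n + 1) h.2 ∂histMeas M p x s
        = ∫⁻ h, ∫⁻ _a, v (n + 1) h.2 ∂p.π s h ∂histMeas M p x s := by simp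
      _ ≤ ∫⁻ h, ∫⁻ a, g (h.2, a) + α * ∫⁻ y, v n y ∂M.q (h.2, a) ∂p.π s h ∂histMeas M p x s :=
          lintegral_mono fun h => lintegral_mono fun a => hle n h.2 a
      _ = ∫⁻ z, g z + α * ∫⁻ y, v n y ∂M.q z ∂saMeas M p x s :=
          (lintegral_saMeas M p x (f := fun z => g z + α * ∫⁻ y, v n y ∂M.q z)
            (hg.add (hq.const_mul α)) s).symm
      _ = ∫⁻ z, g z ∂saMeas M p x s + α * ∫⁻ h, v n h.2 ∂histMeas M p x (s + 1) := by
          rw [lintegral_add_left hg, lintegral_const_mul _ hq, lintegral_histMeas_succ M p x (hv n)]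
      _ ≤ ∫⁻ z, g z ∂saMeas M p x s + α * ∑ t ∈ Finset.range n,
            α ^ t * ∫⁻ z, g z ∂saMeas M p x (s + 1 + t) := by
          gcongr
          exact ih (s + 1)
      _ = _ := by
          rw [Finset.sum_range_succ', add_comm, Finset.mul_sum]
          simp only [pow_zero, one_mul, add_zero]
          congr 1
          refine Finset.sum_congr rfl fun t _ => ?_
          rw [pow_succ', mul_assoc, add_right_comm, add_assoc]

lemma sum_detPolicy_le {α b : ℝ≥0∞} (hg : Measurable g) {v : X → ℝ≥0∞} (hv : Measurable v)
    {φ : X → A} (hφ : Measurable φ)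
    (hle : ∀ x, g (x, φ x) + α * ∫⁻ y, v y ∂M.q (x, φ x) ≤ b + v x) (x : X) (n s : ℕ) :
    ∑ t ∈ Finset.range n, α ^ t * ∫⁻ z, g z ∂saMeas M (detPolicy φ hφ) x (s + t) ≤
      ∑ t ∈ Finset.range n, α ^ t * b + ∫⁻ h, v h.2 ∂histMeas M (detPolicy φ hφ) x s := by
  induction n generalizing s with
  | zero => simp
  | succ n ih =>
    have hq : Measurable fun z => ∫⁻ y, v y ∂M.q z := hv.lintegral_kernel
    set p := detPolicy φ hφ
    have hstep : ∫⁻ z, g z ∂saMeas M p x s + α * ∫⁻ h, v h.2 ∂histMeas M p x (s + 1) ≤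
        b + ∫⁻ h, v h.2 ∂histMeas M p x s := by
      rw [lintegral_histMeas_succ M p x hv, ← lintegral_const_mul _ hq, ← lintegral_add_left hg,
        lintegral_saMeas_detPolicy M x hφ (f := fun z => g z + α * ∫⁻ y, v y ∂M.q z)
          (hg.add (hq.const_mul α)) s]
      calc _ ≤ ∫⁻ h, b + v h.2 ∂histMeas M p x s := lintegral_mono fun h => hle h.2
        _ = _ := by rw [lintegral_add_left measurable_const]; simp
    calc _ = ∫⁻ z, g z ∂saMeas M p x s + α * ∑ t ∈ Finset.range n,
            α ^ t * ∫⁻ z, g z ∂saMeas M p x (s + 1 + t) := by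
          rw [Finset.sum_range_succ', add_comm, Finset.mul_sum]
          simp only [pow_zero, one_mul, add_zero]
          congr 1
          refine Finset.sum_congr rfl fun t _ => ?_
          rw [pow_succ', mul_assoc, add_right_comm, add_assoc]
      _ ≤ ∫⁻ z, g z ∂saMeas M p x s + α * (∑ t ∈ Finset.range n, α ^ t * b +
            ∫⁻ h, v h.2 ∂histMeas M p x (s + 1)) := by
          gcongr
          exact ih (s + 1)
      _ = α * ∑ t ∈ Finset.range n, α ^ t * b + (∫⁻ z, g z ∂saMeas M p x s +
            α * ∫⁻ h, v h.2 ∂histMeas M p x (s + 1)) := by ring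
      _ ≤ α * ∑ t ∈ Finset.range n, α ^ t * b + (b + ∫⁻ h, v h.2 ∂histMeas M p x s) := by
          gcongr
      _ = _ := by
          rw [Finset.sum_range_succ', Finset.mul_sum]
          simp only [pow_succ', mul_assoc, pow_zero, one_mul, add_assoc]

end DynamicProgramming

section DiscountedOptimality

variable {M : MDP X A} {g : X × A → ℝ≥0∞}

/-- Value iteration for the discounted problem. -/
def valueIter (M : MDP X A) (g : X × A → ℝ≥0∞) (α : ℝ≥0∞) : ℕ → X → ℝ≥0∞
  | 0 => 0
  | n + 1 => fun x => ⨅ a, g (x, a) + ∫⁻ y, α * valueIter M g α n y ∂M.q (x, a)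

lemma monotone_valueIter (α : ℝ≥0∞) : Monotone (valueIter M g α) := by
  refine monotone_nat_of_le_succ fun n => ?_
  induction n with
  | zero => exact fun x => zero_le
  | succ n ih =>
    intro x
    refine iInf_mono fun a => ?_
    gcongr
    exact ih _

variable [TopologicalSpace A] [TopologicalSpace.MetrizableSpace A]

lemma lowerSemicontinuous_add_lintegral
    (hc : ∀ x r, r < ⊤ → IsCompact {a | g (x, a) ≤ r})
    (hq : ∀ x B, MeasurableSet B → Continuous fun a => M.q (x, a) B)
    {f : X → ℝ≥0∞} (hf : Measurable f) (x : X) :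
    LowerSemicontinuous fun a => g (x, a) + ∫⁻ y, f y ∂M.q (x, a) := by
  refine LowerSemicontinuous.add (lowerSemicontinuous_iff_isClosed_preimage.2 fun r => ?_)
    (lowerSemicontinuous_lintegral_of_setwise (hq x) hf)
  rcases eq_top_or_lt_top r with rfl | hr
  · simp
  · exact (hc x r hr).isClosed

lemma isCompact_add_lintegral_le
    (hc : ∀ x r, r < ⊤ → IsCompact {a | g (x, a) ≤ r})
    (hq : ∀ x B, MeasurableSet B → Continuous fun a => M.q (x, a) B)
    {f : X → ℝ≥0∞} (hf : Measurable f) (x : X) {r : ℝ≥0∞} (hr : r < ⊤) :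
    IsCompact {a | g (x, a) + ∫⁻ y, f y ∂M.q (x, a) ≤ r} :=
  (hc x r hr).of_isClosed_subset
    ((lowerSemicontinuous_add_lintegral hc hq hf x).isClosed_preimage r)
    fun a (ha : _ ≤ r) => show g (x, a) ≤ r from le_self_add.trans ha

lemma exists_add_lintegral_iSup_le
    (hc : ∀ x r, r < ⊤ → IsCompact {a | g (x, a) ≤ r})
    (hq : ∀ x B, MeasurableSet B → Continuous fun a => M.q (x, a) B)
    {f : ℕ → X → ℝ≥0∞} (hf : ∀ n, Measurable (f n)) (hmono : Monotone f) (x : X) {R : ℝ≥0∞}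
    (hR : R < ⊤)
    (hex : ∀ n ε, 0 < ε → ∃ a, g (x, a) + ∫⁻ y, f n y ∂M.q (x, a) ≤ R + ε) :
    ∃ a, g (x, a) + ∫⁻ y, ⨆ n, f n y ∂M.q (x, a) ≤ R := by
  obtain ⟨a, ha⟩ := exists_forall_le_of_isCompact_sublevel
    (h := fun n a => g (x, a) + ∫⁻ y, f n y ∂M.q (x, a))
    (fun m n hmn a => by
      dsimp only
      gcongr
      exact hmono hmn _)
    (fun n => lowerSemicontinuous_add_lintegral hc hq (hf n) x)
    (fun r hr => isCompact_add_lintegral_le hc hq (hf 0) x hr) hR hex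
  refine ⟨a, ?_⟩
  rw [lintegral_iSup hf hmono, ENNReal.add_iSup]
  exact iSup_le ha

variable [StandardBorelSpace X] [SecondCountableTopology A] [BorelSpace A] [StandardBorelSpace A]

lemma measurable_valueIter (hg : Measurable g)
    (hc : ∀ x r, r < ⊤ → IsCompact {a | g (x, a) ≤ r})
    (hq : ∀ x B, MeasurableSet B → Continuous fun a => M.q (x, a) B) (α : ℝ≥0∞) (n : ℕ) :
    Measurable (valueIter M g α n) := by
  induction n with
  | zero => exact measurable_zero
  | succ n ih =>
    have hf : Measurable fun y => α * valueIter M g α n y := ih.const_mul α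
    exact measurable_iInf_of_isCompact_sublevel
      (h := fun z => g z + ∫⁻ y, α * valueIter M g α n y ∂M.q z)
      (hg.add hf.lintegral_kernel) fun x r hr => isCompact_add_lintegral_le hc hq hf x hr

/-- The discounted optimality inequality, together with measurability of the value function. -/
theorem nnDiscOpt_spec [Nonempty A] (hg : Measurable g)
    (hc : ∀ x r, r < ⊤ → IsCompact {a | g (x, a) ≤ r})
    (hq : ∀ x B, MeasurableSet B → Continuous fun a => M.q (x, a) B) (α : ℝ≥0∞) :
    Measurable (nnDiscOpt M g α) ∧ ∀ x, nnDiscOpt M g α x < ⊤ →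
      ∃ a, g (x, a) + ∫⁻ y, α * nnDiscOpt M g α y ∂M.q (x, a) ≤ nnDiscOpt M g α x := by
  have hv := measurable_valueIter hg hc hq α
  set v := valueIter M g α with hvdef
  have hV : Measurable fun x => ⨆ n, v n x := Measurable.iSup hv
  have hatt : ∀ x, ⨆ n, v n x < ⊤ →
      ∃ a, g (x, a) + ∫⁻ y, α * ⨆ n, v n y ∂M.q (x, a) ≤ ⨆ n, v n x := by
    intro x hx
    simp_rw [ENNReal.mul_iSup]
    refine exists_add_lintegral_iSup_le hc hq (f := fun n y => α * v n y)
      (fun n => (hv n).const_mul α) (fun m n hmn y => ?_) x hx fun n ε hε => ?_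
    · dsimp only
      gcongr
      exact monotone_valueIter α hmn y
    · have h1 : v (n + 1) x < (⨆ n, v n x) + ε :=
        (le_iSup (fun n => v n x) (n + 1)).trans_lt (ENNReal.lt_add_right hx.ne hε.ne')
      obtain ⟨a, ha⟩ := iInf_lt_iff.1 h1
      exact ⟨a, ha.le⟩
  have heq : nnDiscOpt M g α = fun x => ⨆ n, v n x := by
    funext x
    refine le_antisymm ?_ (le_iInf fun p => iSup_le fun n => ?_)
    · obtain ⟨φ, hφ, hle⟩ := exists_measurable_selector_le
        (h := fun z => g z + ∫⁻ y, α * ⨆ n, v n y ∂M.q z)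
        (hg.add (hV.const_mul α).lintegral_kernel)
        (fun x r hr => isCompact_add_lintegral_le hc hq (hV.const_mul α) x hr) hV hatt
      refine (iInf_le _ (detPolicy φ hφ)).trans (ENNReal.tsum_le_of_sum_range_le fun n => ?_)
      have := sum_detPolicy_le M (α := α) (b := 0) hg hV hφ (fun x => by
        simpa [lintegral_const_mul _ hV] using hle x) x n 0
      simpa [lintegral_histMeas_zero M _ x hV] using this
    · have := lintegral_le_sum_of_le M (α := α) hg hv (fun _ => rfl) (fun n x a => by
        rw [← lintegral_const_mul _ (hv n)]
        exact iInf_le _ a) p x n 0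
      rw [lintegral_histMeas_zero M p x (hv n)] at this
      simp only [zero_add] at this
      exact this.trans (ENNReal.sum_le_tsum _)
  rw [heq]
  exact ⟨hV, hatt⟩

/-- The average-cost optimality inequality for a nonnegative cost, obtained along a sequence of
discount factors tending to `1`. -/
theorem exists_selector_average_inequality [Nonempty A] (hg : Measurable g)
    (hc : ∀ x r, r < ⊤ → IsCompact {a | g (x, a) ≤ r})
    (hq : ∀ x B, MeasurableSet B → Continuous fun a => M.q (x, a) B)
    {α : ℕ → ℝ≥0∞} (hα : ∀ n, α n ≤ 1) (hα1 : Tendsto α atTop (𝓝 1))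
    {m : ℕ → ℝ≥0∞} (hm : ∀ n, m n ≠ ⊤) (hmle : ∀ n x, m n ≤ nnDiscOpt M g (α n) x)
    {W : ℝ≥0∞} (hW : W < ⊤) (hWm : limsup (fun n => (1 - α n) * m n) atTop ≤ W)
    (hu : ∀ x, liminf (fun n => nnDiscOpt M g (α n) x - m n) atTop < ⊤) :
    Measurable (fun x => liminf (fun n => nnDiscOpt M g (α n) x - m n) atTop) ∧
    ∃ φ : X → A, Measurable φ ∧ ∀ x, g (x, φ x) +
      ∫⁻ y, liminf (fun n => nnDiscOpt M g (α n) y - m n) atTop ∂M.q (x, φ x) ≤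
        W + liminf (fun n => nnDiscOpt M g (α n) x - m n) atTop := by
  set V : ℕ → X → ℝ≥0∞ := fun n => nnDiscOpt M g (α n) with hVdef
  have hVm : ∀ n, Measurable (V n) := fun n => (nnDiscOpt_spec hg hc hq (α n)).1
  have hum : ∀ n, Measurable fun x => V n x - m n := fun n => (hVm n).sub measurable_const
  have huM : Measurable fun x => liminf (fun n => V n x - m n) atTop := Measurable.liminf hum
  set u : X → ℝ≥0∞ := fun x => liminf (fun n => V n x - m n) atTop with hudef
  let G : ℕ → X → ℝ≥0∞ := fun k y => ⨅ n ≥ k, α n * (V n y - m n)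
  have hG : ∀ k, Measurable (G k) := fun k =>
    Measurable.biInf _ (to_countable _) fun n _ => (hum n).const_mul _
  have hGmono : Monotone G := fun k l hkl y =>
    le_iInf₂ fun n hn => iInf₂_le n (le_trans hkl hn)
  have huG : ∀ y, u y ≤ ⨆ k, G k y := by
    intro y
    have : ⨆ k, G k y = liminf (fun n => α n * (V n y - m n)) atTop :=
      liminf_eq_iSup_iInf_of_nat.symm
    rw [this]
    have h := ENNReal.le_liminf_mul (f := atTop) (u := α) (v := fun n => V n y - m n)
    rw [hα1.liminf_eq, one_mul] at h
    exact h
  have hstep : ∀ n x, V n x < ⊤ →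
      ∃ a, g (x, a) + ∫⁻ y, α n * (V n y - m n) ∂M.q (x, a) ≤ (1 - α n) * m n + (V n x - m n) := by
    intro n x hx
    obtain ⟨a, ha⟩ := (nnDiscOpt_spec hg hc hq (α n)).2 x hx
    refine ⟨a, ?_⟩
    have hfin : α n * m n ≠ ⊤ := ENNReal.mul_ne_top ((hα n).trans_lt ENNReal.one_lt_top).ne (hm n)
    rw [← ENNReal.add_le_add_iff_right hfin]
    calc g (x, a) + ∫⁻ y, α n * (V n y - m n) ∂M.q (x, a) + α n * m n
        = g (x, a) + ∫⁻ y, α n * V n y ∂M.q (x, a) := by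
          rw [add_assoc]
          congr 1
          calc _ = ∫⁻ y, α n * (V n y - m n) ∂M.q (x, a) + ∫⁻ _y, α n * m n ∂M.q (x, a) := by
                simp
            _ = _ := by
              rw [← lintegral_add_right _ measurable_const]
              refine lintegral_congr fun y => ?_
              rw [← mul_add, tsub_add_cancel_of_le (hmle n y)]
      _ ≤ V n x := ha
      _ = (V n x - m n) + ((1 - α n) + α n) * m n := by
          rw [tsub_add_cancel_of_le (hα n), one_mul, tsub_add_cancel_of_le (hmle n x)]
      _ = _ := by ring
  have hatt : ∀ x, ∃ a, g (x, a) + ∫⁻ y, u y ∂M.q (x, a) ≤ W + u x := by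
    intro x
    obtain ⟨a, ha⟩ := exists_add_lintegral_iSup_le hc hq hG hGmono x (R := W + u x)
      (ENNReal.add_lt_top.2 ⟨hW, hu x⟩) (fun k ε hε => by
        have hε2 : ε / 2 ≠ 0 := (ENNReal.half_pos hε.ne').ne'
        have h1 : ∃ᶠ n in atTop, V n x - m n < u x + ε / 2 :=
          frequently_lt_of_liminf_lt (h := ENNReal.lt_add_right (hu x).ne hε2)
        have h2 : ∀ᶠ n in atTop, (1 - α n) * m n < W + ε / 2 :=
          eventually_lt_of_limsup_lt (hWm.trans_lt (ENNReal.lt_add_right hW.ne hε2))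
        obtain ⟨n, hn1, hn2, hnk⟩ := (h1.and_eventually (h2.and (eventually_ge_atTop k))).exists
        have hVx : V n x < ⊤ := by
          have hV : V n x - m n + m n = V n x := tsub_add_cancel_of_le (hmle n x)
          rw [← hV]
          exact ENNReal.add_lt_top.2 ⟨hn1.trans_le le_top, (hm n).lt_top⟩
        obtain ⟨a, ha⟩ := hstep n x hVx
        refine ⟨a, ?_⟩
        calc g (x, a) + ∫⁻ y, G k y ∂M.q (x, a)
            ≤ g (x, a) + ∫⁻ y, α n * (V n y - m n) ∂M.q (x, a) := by
              gcongr with y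
              exact iInf₂_le n hnk
          _ ≤ (1 - α n) * m n + (V n x - m n) := ha
          _ ≤ (W + ε / 2) + (u x + ε / 2) := by gcongr
          _ = W + u x + (ε / 2 + ε / 2) := by ring
          _ = W + u x + ε := by rw [ENNReal.add_halves])
    refine ⟨a, le_trans ?_ ha⟩
    gcongr with y
    exact huG y
  exact ⟨huM, exists_measurable_selector_le (h := fun z => g z + ∫⁻ y, u y ∂M.q z)
    (hg.add huM.lintegral_kernel) (fun x r hr => isCompact_add_lintegral_le hc hq huM x hr)
    (measurable_const.add huM) fun x _ => hatt x⟩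

end DiscountedOptimality

section Abelian

lemma tsum_pow_mul_le_of_sum_le {e : ℕ → ℝ≥0∞} {C L α : ℝ≥0∞} (hC : C ≠ ⊤) (hL : L ≠ ⊤)
    (hα : α ≤ 1) (hsum : ∀ N : ℕ, ∑ t ∈ Finset.range N, e t ≤ C + N * L) :
    ∑' t, α ^ t * e t ≤ C + L * (1 - α)⁻¹ := by
  have key : ∀ N : ℕ, ∃ r, ∑ t ∈ Finset.range N, e t + r = C + N * L ∧
      ∑ t ∈ Finset.range N, α ^ t * e t + α ^ N * r ≤ C + L * ∑ t ∈ Finset.range N, α ^ t := by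
    intro N
    induction N with
    | zero => exact ⟨C, by simp⟩
    | succ N ih =>
      obtain ⟨r, hr, hle⟩ := ih
      obtain ⟨r', hr'⟩ := exists_add_of_le (hsum (N + 1))
      refine ⟨r', hr'.symm, ?_⟩
      have hfin : ∑ t ∈ Finset.range N, e t ≠ ⊤ :=
        ne_top_of_le_ne_top (by finiteness) (hsum N)
      have heq : e N + r' = r + L := by
        rw [← ENNReal.add_right_inj hfin, ← add_assoc, ← Finset.sum_range_succ, ← hr', ← add_assoc,
          hr]
        push_cast
        ring
      calc ∑ t ∈ Finset.range (N + 1), α ^ t * e t + α ^ (N + 1) * r'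
          ≤ ∑ t ∈ Finset.range (N + 1), α ^ t * e t + α ^ N * r' := by
            gcongr 2
            exact pow_le_pow_of_le_one zero_le hα N.le_succ
        _ = ∑ t ∈ Finset.range N, α ^ t * e t + α ^ N * (e N + r') := by
            rw [Finset.sum_range_succ]; ring
        _ = ∑ t ∈ Finset.range N, α ^ t * e t + α ^ N * r + α ^ N * L := by rw [heq]; ring
        _ ≤ C + L * ∑ t ∈ Finset.range N, α ^ t + α ^ N * L := by gcongr
        _ = _ := by rw [Finset.sum_range_succ]; ring
  refine ENNReal.tsum_le_of_sum_range_le fun N => ?_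
  obtain ⟨r, -, hr⟩ := key N
  refine le_self_add.trans (hr.trans ?_)
  rw [← ENNReal.tsum_geometric]
  gcongr
  exact ENNReal.sum_le_tsum _

lemma exists_sum_le_of_limsup_lt {e : ℕ → ℝ≥0∞} {L : ℝ≥0∞} (hL : L ≠ ⊤)
    (h : limsup (fun N : ℕ => (N : ℝ≥0∞)⁻¹ * ∑ t ∈ Finset.range N, e t) atTop < L) :
    ∃ C : ℝ≥0∞, C ≠ ⊤ ∧ ∀ N : ℕ, ∑ t ∈ Finset.range N, e t ≤ C + N * L := by
  have hev := (eventually_lt_of_limsup_lt h).and (eventually_ge_atTop 1)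
  obtain ⟨N₀, hN₀⟩ := eventually_atTop.1 hev
  have hle : ∀ N ≥ N₀, ∑ t ∈ Finset.range N, e t ≤ N * L := by
    intro N hN
    obtain ⟨h1, h2⟩ := hN₀ N hN
    have hN0 : (N : ℝ≥0∞) ≠ 0 := by simp; omega
    calc ∑ t ∈ Finset.range N, e t = N * ((N : ℝ≥0∞)⁻¹ * ∑ t ∈ Finset.range N, e t) := by
          rw [← mul_assoc, ENNReal.mul_inv_cancel hN0 (by simp), one_mul]
      _ ≤ N * L := by gcongr
  refine ⟨N₀ * L, by finiteness, fun N => ?_⟩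
  rcases le_total N₀ N with hN | hN
  · exact (hle N hN).trans le_add_self
  · refine le_trans ?_ ((hle N₀ le_rfl).trans le_self_add)
    exact Finset.sum_le_sum_of_subset (Finset.range_mono hN)

lemma limsup_inv_mul_le {s : ℕ → ℝ≥0∞} {W b : ℝ≥0∞} (hb : b ≠ ⊤)
    (h : ∀ N : ℕ, s N ≤ N * W + b) :
    limsup (fun N : ℕ => (N : ℝ≥0∞)⁻¹ * s N) atTop ≤ W := by
  have hlim : Tendsto (fun N : ℕ => W + (N : ℝ≥0∞)⁻¹ * b) atTop (𝓝 W) := by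
    have := ENNReal.Tendsto.mul_const (b := b) ENNReal.tendsto_inv_nat_nhds_zero (Or.inr hb)
    simpa using (tendsto_const_nhds (x := W)).add this
  rw [← hlim.limsup_eq]
  refine limsup_le_limsup ?_
  filter_upwards [eventually_ge_atTop 1] with N hN
  have hN0 : (N : ℝ≥0∞) ≠ 0 := by simp; omega
  calc (N : ℝ≥0∞)⁻¹ * s N ≤ (N : ℝ≥0∞)⁻¹ * (N * W + b) := by gcongr; exact h N
    _ = _ := by rw [mul_add, ← mul_assoc, ENNReal.inv_mul_cancel hN0 (by simp), one_mul]

end Abelian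

section ExtendedReal

lemma coe_ofReal_of_nonneg {r : ℝ} (hr : 0 ≤ r) : ((ENNReal.ofReal r : ℝ≥0∞) : EReal) = r := by
  rw [EReal.coe_ennreal_ofReal, max_eq_left hr]

lemma coe_sub_eq_coe_sub {a b c d : ℝ≥0∞} (hb : b ≠ ⊤) (hd : d ≠ ⊤) (h : a + d = c + b) :
    (a : EReal) - b = (c : EReal) - d := by
  lift b to ℝ≥0 using hb
  lift d to ℝ≥0 using hd
  rcases eq_or_ne a ⊤ with rfl | ha
  · have hc : c = ⊤ := by simpa using h.symm
    subst hc
    rfl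
  · have hc : c ≠ ⊤ := by
      rintro rfl
      simp [ENNReal.add_eq_top, ha] at h
    lift a to ℝ≥0 using ha
    lift c to ℝ≥0 using hc
    have h' : (a : ℝ) + d = c + b := by exact_mod_cast h
    have h2 : (a : ℝ) - b = c - d := by linarith
    simp only [EReal.coe_nnreal_eq_coe_real]
    exact_mod_cast congrArg Real.toEReal h2

lemma coe_sub_add_coe_sub {a b c d : ℝ≥0∞} (hb : b ≠ ⊤) :
    ((a : EReal) - b) + ((c : EReal) - d) =
      ((a + c : ℝ≥0∞) : EReal) - ((b + d : ℝ≥0∞) : EReal) := by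
  have hb' : (b : EReal) ≠ ⊤ := by simpa using hb
  push_cast
  rw [sub_eq_add_neg, sub_eq_add_neg, sub_eq_add_neg,
    EReal.neg_add (.inl (by simp)) (.inl hb'), sub_eq_add_neg, add_add_add_comm]

lemma coe_mul_coe_sub {r : ℝ} (hr : 0 ≤ r) (a b : ℝ≥0∞) :
    (r : EReal) * ((a : EReal) - b) =
      ((ENNReal.ofReal r * a : ℝ≥0∞) : EReal) - ((ENNReal.ofReal r * b : ℝ≥0∞) : EReal) := by
  rw [EReal.coe_ennreal_mul, EReal.coe_ennreal_mul, coe_ofReal_of_nonneg hr,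
    EReal.mul_sub_of_nonneg_of_ne_top (by exact_mod_cast hr) (EReal.coe_ne_top r)]

lemma monotone_coe_sub (k : ℝ≥0∞) : Monotone fun a : ℝ≥0∞ => (a : EReal) - k :=
  fun _ _ h => EReal.sub_le_sub (by exact_mod_cast h) le_rfl

lemma continuous_coe_sub {k : ℝ≥0∞} (hk : k ≠ ⊤) :
    Continuous fun a : ℝ≥0∞ => (a : EReal) - k := by
  refine continuous_iff_continuousAt.2 fun a => ?_
  have h : ContinuousAt (fun p : EReal × EReal => p.1 + p.2) ((a : EReal), -(k : EReal)) :=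
    EReal.continuousAt_add (.inr (by simpa using hk)) (.inl (by simp))
  exact h.comp (f := fun a : ℝ≥0∞ => ((a : EReal), -(k : EReal)))
    (continuous_coe_ennreal_ereal.prodMk continuous_const).continuousAt

lemma coe_top_sub {k : ℝ≥0∞} (hk : k ≠ ⊤) : ((⊤ : ℝ≥0∞) : EReal) - k = ⊤ := by
  lift k to ℝ≥0 using hk
  rfl

lemma iInf_coe_sub {ι : Sort*} (f : ι → ℝ≥0∞) {k : ℝ≥0∞} (hk : k ≠ ⊤) :
    ⨅ i, ((f i : EReal) - k) = ((⨅ i, f i : ℝ≥0∞) : EReal) - k :=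
  (Monotone.map_iInf_of_continuousAt (continuous_coe_sub hk).continuousAt (monotone_coe_sub k)
    (coe_top_sub hk)).symm

lemma limsup_coe_sub {ι : Type*} {F : Filter ι} [F.NeBot] (f : ι → ℝ≥0∞) {k : ℝ≥0∞}
    (hk : k ≠ ⊤) :
    limsup (fun i => (f i : EReal) - k) F = ((limsup f F : ℝ≥0∞) : EReal) - k :=
  ((monotone_coe_sub k).map_limsup_of_continuousAt f (continuous_coe_sub hk).continuousAt).symm

lemma coe_sub_le_coe_sub_iff {a b k : ℝ≥0∞} (hk : k ≠ ⊤) :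
    (a : EReal) - k ≤ (b : EReal) - k ↔ a ≤ b := by
  refine ⟨fun h => ?_, fun h => monotone_coe_sub k h⟩
  have hk' : (k : EReal) ≠ ⊤ := by simpa using hk
  rw [EReal.sub_le_iff_le_add (.inl (by simp)) (.inl hk')] at h
  lift k to ℝ≥0 using hk
  have : (b : EReal) - (k : ℝ≥0∞) + (k : ℝ≥0∞) = b := EReal.sub_add_cancel (b := (k : ℝ))
  rw [this] at h
  exact_mod_cast h

lemma eToENN_coe_sub {a b : ℝ≥0∞} : eToENN ((a : EReal) - b) = a - b :=
  (EReal.toENNReal_sub (EReal.coe_ennreal_nonneg b)).trans (by simp)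

lemma eToENN_neg_coe_sub {a b : ℝ≥0∞} (hb : b ≠ ⊤) : eToENN (-((a : EReal) - b)) = b - a := by
  have hb' : (b : EReal) ≠ ⊤ := by simpa using hb
  rw [EReal.neg_sub (.inr (by simp)) (.inr hb'), add_comm, ← sub_eq_add_neg, eToENN_coe_sub]

lemma eInt_coe_sub {Y : Type*} [MeasurableSpace Y] {μ : Measure Y} {C k : Y → ℝ≥0∞}
    (hC : Measurable C) (hk : Measurable k) (hk_top : ∀ y, k y ≠ ⊤) (hint : ∫⁻ y, k y ∂μ ≠ ⊤) :
    eInt μ (fun y => (C y : EReal) - k y) =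
      ((∫⁻ y, C y ∂μ : ℝ≥0∞) : EReal) - ((∫⁻ y, k y ∂μ : ℝ≥0∞) : EReal) := by
  rw [eInt]
  simp_rw [eToENN_coe_sub, eToENN_neg_coe_sub (hk_top _)]
  refine coe_sub_eq_coe_sub (ne_top_of_le_ne_top hint (lintegral_mono fun y => tsub_le_self))
    hint ?_
  rw [← lintegral_add_right _ hk, ← lintegral_add_left hC]
  refine lintegral_congr fun y => ?_
  rw [tsub_add_eq_max, add_comm, tsub_add_eq_max, max_comm]

lemma eInt_coe {Y : Type*} [MeasurableSpace Y] (μ : Measure Y) {C : Y → ℝ≥0∞}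
    (hC : Measurable C) : eInt μ (fun y => (C y : EReal)) = ((∫⁻ y, C y ∂μ : ℝ≥0∞) : EReal) := by
  simpa using eInt_coe_sub (μ := μ) (k := 0) hC measurable_zero (by simp) (by simp)

lemma eSum_coe_sub {C k : ℕ → ℝ≥0∞} (hk : ∑' t, k t ≠ ⊤) :
    eSum (fun t => (C t : EReal) - k t) =
      ((∑' t, C t : ℝ≥0∞) : EReal) - ((∑' t, k t : ℝ≥0∞) : EReal) := by
  have h := eInt_coe_sub (μ := Measure.count) (C := C) (k := k) measurable_from_top
    measurable_from_top (ENNReal.ne_top_of_tsum_ne_top hk) (by rwa [lintegral_count])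
  rw [eInt] at h
  simp only [lintegral_count] at h
  exact h

end ExtendedReal

section Translation

variable {M : MDP X A} {g : X × A → ℝ≥0∞} {k : ℝ≥0∞}

/-- A cost bounded below is a nonnegative cost minus a finite constant. -/
lemma exists_cost_eq_coe_sub (M : MDP X A) : ∃ (g : X × A → ℝ≥0∞) (k : ℝ≥0∞), Measurable g ∧
    k ≠ ⊤ ∧ ∀ x a, M.c x a = (g (x, a) : EReal) - k := by
  obtain ⟨K, hK⟩ := M.c_ne_bot
  let r : ℝ := max 0 (-K)
  have hr : 0 ≤ r := le_max_left _ _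
  refine ⟨fun z => (M.c z.1 z.2 + (r : EReal)).toENNReal, ENNReal.ofReal r, ?_,
    ENNReal.ofReal_ne_top, fun x a => ?_⟩
  · have hadd : Continuous fun y : EReal => y + (r : EReal) := by
      refine continuous_iff_continuousAt.2 fun y => ?_
      have h : ContinuousAt (fun p : EReal × EReal => p.1 + p.2) (y, (r : EReal)) :=
        EReal.continuousAt_add (.inr (by simp)) (.inr (by simp))
      exact h.comp (f := fun y : EReal => (y, (r : EReal)))
        (continuous_id.prodMk continuous_const).continuousAt
    exact measurable_ereal_toENNReal.comp (hadd.measurable.comp M.c_meas)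
  · have h0 : 0 ≤ M.c x a + (r : EReal) :=
      calc (0 : EReal) ≤ ((K + r : ℝ) : EReal) := by
            exact_mod_cast (by linarith [le_max_right 0 (-K)] : 0 ≤ K + r)
        _ = (K : EReal) + r := EReal.coe_add K r
        _ ≤ _ := by gcongr; exact hK x a
    rw [EReal.coe_toENNReal h0, coe_ofReal_of_nonneg hr, EReal.add_sub_cancel_right]

lemma expCost_eq (hg : Measurable g) (hk : k ≠ ⊤)
    (hc : ∀ x a, M.c x a = (g (x, a) : EReal) - k) (p : Policy X A) (x : X) (t : ℕ) :
    expCost M p x t = ((∫⁻ z, g z ∂saMeas M p x t : ℝ≥0∞) : EReal) - k := by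
  rw [expCost]
  simp_rw [hc]
  have := eInt_coe_sub (μ := saMeas M p x t) (k := fun _ => k) hg measurable_const (fun _ => hk)
    (by simpa using hk)
  simpa using this

lemma tsum_ofReal_pow_ne_top {α : ℝ} (hα : α ∈ Set.Ico (0 : ℝ) 1) :
    ∑' t : ℕ, ENNReal.ofReal α ^ t ≠ ⊤ := by
  have h : ENNReal.ofReal α < 1 := by simpa using hα.2
  rw [ENNReal.tsum_geometric]
  exact ENNReal.inv_ne_top.2 (tsub_pos_of_lt h).ne'

lemma vDisc_eq (hg : Measurable g) (hk : k ≠ ⊤)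
    (hc : ∀ x a, M.c x a = (g (x, a) : EReal) - k) {α : ℝ} (hα : α ∈ Set.Ico (0 : ℝ) 1)
    (p : Policy X A) (x : X) :
    vDisc M α p x = (nnDisc M g (ENNReal.ofReal α) p x : EReal) -
      (((∑' t : ℕ, ENNReal.ofReal α ^ t) * k : ℝ≥0∞) : EReal) := by
  have h : ∑' t : ℕ, ENNReal.ofReal α ^ t * k ≠ ⊤ := by
    rw [ENNReal.tsum_mul_right]
    exact ENNReal.mul_ne_top (tsum_ofReal_pow_ne_top hα) hk
  rw [vDisc, nnDisc, ← ENNReal.tsum_mul_right, ← eSum_coe_sub h]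
  congr 1
  funext t
  rw [expCost_eq hg hk hc, coe_mul_coe_sub (pow_nonneg hα.1 t), ENNReal.ofReal_pow hα.1]

lemma vDiscOpt_eq (hg : Measurable g) (hk : k ≠ ⊤)
    (hc : ∀ x a, M.c x a = (g (x, a) : EReal) - k) {α : ℝ} (hα : α ∈ Set.Ico (0 : ℝ) 1) (x : X) :
    vDiscOpt M α x = (nnDiscOpt M g (ENNReal.ofReal α) x : EReal) -
      (((∑' t : ℕ, ENNReal.ofReal α ^ t) * k : ℝ≥0∞) : EReal) := by
  rw [vDiscOpt, nnDiscOpt, ← iInf_coe_sub _ (ENNReal.mul_ne_top (tsum_ofReal_pow_ne_top hα) hk)]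
  exact iInf_congr fun p => vDisc_eq hg hk hc hα p x

lemma mDisc_eq (hg : Measurable g) (hk : k ≠ ⊤)
    (hc : ∀ x a, M.c x a = (g (x, a) : EReal) - k) {α : ℝ} (hα : α ∈ Set.Ico (0 : ℝ) 1) :
    mDisc M α = ((⨅ x, nnDiscOpt M g (ENNReal.ofReal α) x : ℝ≥0∞) : EReal) -
      (((∑' t : ℕ, ENNReal.ofReal α ^ t) * k : ℝ≥0∞) : EReal) := by
  rw [mDisc, ← iInf_coe_sub _ (ENNReal.mul_ne_top (tsum_ofReal_pow_ne_top hα) hk)]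
  exact iInf_congr fun x => vDiscOpt_eq hg hk hc hα x

lemma one_sub_mul_mDisc_eq (hg : Measurable g) (hk : k ≠ ⊤)
    (hc : ∀ x a, M.c x a = (g (x, a) : EReal) - k) {α : ℝ} (hα : α ∈ Set.Ico (0 : ℝ) 1) :
    ((1 - α : ℝ) : EReal) * mDisc M α =
      (((1 - ENNReal.ofReal α) * ⨅ x, nnDiscOpt M g (ENNReal.ofReal α) x : ℝ≥0∞) : EReal) - k := by
  have h1 : ENNReal.ofReal (1 - α) = 1 - ENNReal.ofReal α := by
    rw [ENNReal.ofReal_sub 1 hα.1, ENNReal.ofReal_one]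
  have hpos : 1 - ENNReal.ofReal α ≠ 0 := by
    rw [← h1]
    simpa using hα.2
  have hfin : 1 - ENNReal.ofReal α ≠ ⊤ := by finiteness
  rw [mDisc_eq hg hk hc hα, coe_mul_coe_sub (by linarith [hα.2]), h1, ENNReal.tsum_geometric,
    ← mul_assoc _ _ k, ENNReal.mul_inv_cancel hpos hfin, one_mul]

lemma uDisc_eq (hg : Measurable g) (hk : k ≠ ⊤)
    (hc : ∀ x a, M.c x a = (g (x, a) : EReal) - k) {α : ℝ} (hα : α ∈ Set.Ico (0 : ℝ) 1)
    (hm : ⨅ x, nnDiscOpt M g (ENNReal.ofReal α) x ≠ ⊤) (x : X) :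
    uDisc M α x = ((nnDiscOpt M g (ENNReal.ofReal α) x -
      ⨅ x, nnDiscOpt M g (ENNReal.ofReal α) x : ℝ≥0∞) : EReal) := by
  have hκ := ENNReal.mul_ne_top (tsum_ofReal_pow_ne_top hα) hk
  have hle : ⨅ x, nnDiscOpt M g (ENNReal.ofReal α) x ≤ nnDiscOpt M g (ENNReal.ofReal α) x :=
    iInf_le _ x
  rw [uDisc, mDisc_eq hg hk hc hα, vDiscOpt_eq hg hk hc hα]
  generalize (∑' t : ℕ, ENNReal.ofReal α ^ t) * k = κ at hκ
  generalize nnDiscOpt M g (ENNReal.ofReal α) x = v at hle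
  generalize ⨅ x, nnDiscOpt M g (ENNReal.ofReal α) x = m at hle hm
  lift κ to ℝ≥0 using hκ
  lift m to ℝ≥0 using hm
  rcases eq_or_ne v ⊤ with rfl | hv
  · rfl
  · lift v to ℝ≥0 using hv
    have hle' : m ≤ v := by exact_mod_cast hle
    have h : ((v : ℝ) - κ) - (m - κ) = ((v - m : ℝ≥0) : ℝ) := by
      rw [NNReal.coe_sub hle']; ring
    rw [← ENNReal.coe_sub]
    simp only [EReal.coe_nnreal_eq_coe_real]
    exact_mod_cast congrArg Real.toEReal h

lemma vFin_eq (hg : Measurable g) (hk : k ≠ ⊤)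
    (hc : ∀ x a, M.c x a = (g (x, a) : EReal) - k) (p : Policy X A) (x : X) (N : ℕ) :
    vFin M N p x = ((∑ t ∈ Finset.range N, ∫⁻ z, g z ∂saMeas M p x t : ℝ≥0∞) : EReal) -
      ((N * k : ℝ≥0∞) : EReal) := by
  rw [vFin]
  induction N with
  | zero => simp
  | succ N ih =>
    rw [Finset.sum_range_succ, ih, expCost_eq hg hk hc, coe_sub_add_coe_sub (by finiteness),
      Finset.sum_range_succ, Nat.cast_succ, add_mul, one_mul]

lemma avgCost_eq (hg : Measurable g) (hk : k ≠ ⊤)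
    (hc : ∀ x a, M.c x a = (g (x, a) : EReal) - k) (p : Policy X A) (x : X) :
    avgCost M p x = ((limsup (fun N : ℕ => (N : ℝ≥0∞)⁻¹ *
      ∑ t ∈ Finset.range N, ∫⁻ z, g z ∂saMeas M p x t) atTop : ℝ≥0∞) : EReal) - k := by
  rw [avgCost, ← limsup_coe_sub _ hk]
  refine limsup_congr ?_
  filter_upwards [eventually_ge_atTop 1] with N hN
  have hN0 : (0 : ℝ) < N := by exact_mod_cast hN
  have hN1 : (N : ℝ≥0∞) ≠ 0 := by simp; omega
  rw [vFin_eq hg hk hc, coe_mul_coe_sub (inv_nonneg.2 hN0.le), ENNReal.ofReal_inv_of_pos hN0,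
    ENNReal.ofReal_natCast, ← mul_assoc _ _ k, ENNReal.inv_mul_cancel hN1 (by simp), one_mul]

instance neBot_nhdsWithin_Ico_one : (𝓝[Set.Ico (0 : ℝ) 1] 1).NeBot := by
  rw [← mem_closure_iff_nhdsWithin_neBot, closure_Ico (by norm_num)]
  simp

lemma wBar_eq (hg : Measurable g) (hk : k ≠ ⊤)
    (hc : ∀ x a, M.c x a = (g (x, a) : EReal) - k) :
    wBar M = ((limsup (fun α : ℝ => (1 - ENNReal.ofReal α) *
      ⨅ x, nnDiscOpt M g (ENNReal.ofReal α) x) (𝓝[Set.Ico (0 : ℝ) 1] 1) : ℝ≥0∞) : EReal) - k := by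
  rw [wBar, ← limsup_coe_sub _ hk]
  refine limsup_congr ?_
  filter_upwards [self_mem_nhdsWithin] with α hα
  exact one_sub_mul_mDisc_eq hg hk hc hα

lemma exists_nnDisc_le_of_limsup_lt {L : ℝ≥0∞} (hL : L ≠ ⊤) {p : Policy X A} {x : X}
    (h : limsup (fun N : ℕ => (N : ℝ≥0∞)⁻¹ *
      ∑ t ∈ Finset.range N, ∫⁻ z, g z ∂saMeas M p x t) atTop < L) :
    ∃ C : ℝ≥0∞, C ≠ ⊤ ∧ ∀ α : ℝ≥0∞, α ≤ 1 → nnDisc M g α p x ≤ C + L * (1 - α)⁻¹ := by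
  obtain ⟨C, hC, hsum⟩ := exists_sum_le_of_limsup_lt hL h
  exact ⟨C, hC, fun α hα => tsum_pow_mul_le_of_sum_le hC hL hα hsum⟩

/-- The Abelian upper limit of the minimal discounted costs is at most any average cost. -/
lemma limsup_iInf_nnDiscOpt_le {p : Policy X A} {x : X} :
    limsup (fun α : ℝ => (1 - ENNReal.ofReal α) * ⨅ x, nnDiscOpt M g (ENNReal.ofReal α) x)
      (𝓝[Set.Ico (0 : ℝ) 1] 1) ≤
    limsup (fun N : ℕ => (N : ℝ≥0∞)⁻¹ *
      ∑ t ∈ Finset.range N, ∫⁻ z, g z ∂saMeas M p x t) atTop := by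
  refine le_of_forall_gt_imp_ge_of_dense fun L hL => ?_
  rcases eq_or_ne L ⊤ with rfl | hLt
  · exact le_top
  obtain ⟨C, hC, hle⟩ := exists_nnDisc_le_of_limsup_lt hLt hL
  have hlim : Tendsto (fun α : ℝ => (1 - ENNReal.ofReal α) * C + L)
      (𝓝[Set.Ico (0 : ℝ) 1] 1) (𝓝 L) := by
    have h1 : Tendsto (fun α : ℝ => 1 - ENNReal.ofReal α) (𝓝[Set.Ico (0 : ℝ) 1] 1) (𝓝 0) := by
      have h2 : Tendsto (fun α : ℝ => ENNReal.ofReal (1 - α)) (𝓝 1) (𝓝 (ENNReal.ofReal (1 - 1))) :=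
        (ENNReal.continuous_ofReal.comp (continuous_const.sub continuous_id)).tendsto 1
      simp only [sub_self, ENNReal.ofReal_zero] at h2
      refine (h2.mono_left nhdsWithin_le_nhds).congr' ?_
      filter_upwards [self_mem_nhdsWithin] with α hα
      rw [ENNReal.ofReal_sub 1 hα.1, ENNReal.ofReal_one]
    simpa using (ENNReal.Tendsto.mul_const (b := C) h1 (Or.inr hC)).add
      (tendsto_const_nhds (x := L))
  rw [← hlim.limsup_eq]
  refine limsup_le_limsup ?_
  filter_upwards [self_mem_nhdsWithin] with α hα
  have hα1 : ENNReal.ofReal α < 1 := by simpa using hα.2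
  have hpos : 1 - ENNReal.ofReal α ≠ 0 := (tsub_pos_of_lt hα1).ne'
  have hfin : 1 - ENNReal.ofReal α ≠ ⊤ := by finiteness
  calc (1 - ENNReal.ofReal α) * ⨅ x, nnDiscOpt M g (ENNReal.ofReal α) x
      ≤ (1 - ENNReal.ofReal α) * (C + L * (1 - ENNReal.ofReal α)⁻¹) := by
        gcongr
        exact (iInf_le _ x).trans ((iInf_le _ p).trans (hle _ hα1.le))
    _ = (1 - ENNReal.ofReal α) * C +
          L * ((1 - ENNReal.ofReal α) * (1 - ENNReal.ofReal α)⁻¹) := by ring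
    _ = _ := by rw [ENNReal.mul_inv_cancel hpos hfin, mul_one]

end Translation

section Statements

variable {X A : Type*} [MetricSpace X] [TopologicalSpace.SeparableSpace X]
  [MeasurableSpace X] [BorelSpace X] [StandardBorelSpace X]
  [MetricSpace A] [TopologicalSpace.SeparableSpace A]
  [MeasurableSpace A] [BorelSpace A] [StandardBorelSpace A]

/-- Theorem 3.3. Under Assumptions S* and B̲_{{α_n}}, with
`u(x) := liminf_{n→∞} u_{α_n}(x)`, there exists a deterministic policy `φ`
satisfying the WACOI with this `u`; consequently `φ` is average-cost optimal. -/
theorem statement2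
    (M : MDP X A)
    (hS1 : AssumptionSi M) (hS2 : AssumptionSii M)
    (a : ℕ → ℝ)
    (ha : ∀ n, a n ∈ Set.Ico (0 : ℝ) 1) (hamono : Monotone a)
    (hatend : Tendsto a atTop (𝓝 (1 : ℝ)))
    (hB1 : wStar M < ⊤)
    (hB2 : ∀ x, Filter.liminf (fun n => uDisc M (a n) x) atTop < ⊤) :
    ∃ (φ : X → A) (hφ : Measurable φ),
      (∀ x, M.c x (φ x) + eInt (M.q (x, φ x)) (uPointwise M a)
        ≤ wBar M + uPointwise M a x)
      ∧ (∀ x, avgCost M (detPolicy φ hφ) x = avgOpt M x) := by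
  have : SecondCountableTopology A := UniformSpace.secondCountable_of_separable A
  obtain ⟨g, k, hg, hk, hc⟩ := exists_cost_eq_coe_sub M
  obtain ⟨x₀, hx₀⟩ := iInf_lt_iff.1 hB1
  obtain ⟨p₀, hp₀⟩ := iInf_lt_iff.1 hx₀
  have : Nonempty A := nonempty_of_isProbabilityMeasure (p₀.π 0 (Fin.elim0, x₀))
  rw [avgCost_eq hg hk hc] at hp₀
  have hlim₀ : limsup (fun N : ℕ => (N : ℝ≥0∞)⁻¹ *
      ∑ t ∈ Finset.range N, ∫⁻ z, g z ∂saMeas M p₀ x₀ t) atTop < ⊤ := by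
    refine lt_top_iff_ne_top.2 fun h => ?_
    rw [h, coe_top_sub hk] at hp₀
    exact hp₀.ne rfl
  let m : ℝ → ℝ≥0∞ := fun α => ⨅ x, nnDiscOpt M g (ENNReal.ofReal α) x
  set W : ℝ≥0∞ := limsup (fun α : ℝ => (1 - ENNReal.ofReal α) * m α) (𝓝[Set.Ico (0 : ℝ) 1] 1)
    with hWdef
  have hW : W < ⊤ := limsup_iInf_nnDiscOpt_le.trans_lt hlim₀
  have hm : ∀ α ∈ Set.Ico (0 : ℝ) 1, m α ≠ ⊤ := by
    intro α hα
    obtain ⟨L, hL, hLt⟩ := exists_between hlim₀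
    obtain ⟨C, hC, hle⟩ := exists_nnDisc_le_of_limsup_lt hLt.ne hL
    have hα1 : ENNReal.ofReal α < 1 := by simpa using hα.2
    have hinv : (1 - ENNReal.ofReal α)⁻¹ ≠ ⊤ := ENNReal.inv_ne_top.2 (tsub_pos_of_lt hα1).ne'
    have hfin : C + L * (1 - ENNReal.ofReal α)⁻¹ ≠ ⊤ :=
      ENNReal.add_ne_top.2 ⟨hC, ENNReal.mul_ne_top hLt.ne hinv⟩
    exact ne_top_of_le_ne_top hfin ((iInf_le _ x₀).trans ((iInf_le _ p₀).trans (hle _ hα1.le)))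
  have hu_eq : ∀ x, uPointwise M a x = ((liminf (fun n =>
      nnDiscOpt M g (ENNReal.ofReal (a n)) x - m (a n)) atTop : ℝ≥0∞) : EReal) := by
    intro x
    rw [uPointwise, Monotone.map_liminf_of_continuousAt EReal.coe_ennreal_strictMono.monotone _
      continuous_coe_ennreal_ereal.continuousAt]
    congr 1
    funext n
    exact uDisc_eq hg hk hc (ha n) (hm _ (ha n)) x
  have hu_top : ∀ x, liminf (fun n =>
      nnDiscOpt M g (ENNReal.ofReal (a n)) x - m (a n)) atTop < ⊤ := by
    intro x
    have h : uPointwise M a x < ⊤ := hB2 x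
    rw [hu_eq] at h
    simpa [lt_top_iff_ne_top] using h
  have hcomp : ∀ x r, r < ⊤ → IsCompact {b | g (x, b) ≤ r} := by
    intro x r hr
    have h := hS1 x (r.toReal - k.toReal)
    have hset : {b | M.c x b ≤ ((r.toReal - k.toReal : ℝ) : EReal)} = {b | g (x, b) ≤ r} := by
      ext b
      have hrk : ((r.toReal - k.toReal : ℝ) : EReal) = (r : EReal) - k := by
        lift r to ℝ≥0 using hr.ne
        lift k to ℝ≥0 using hk
        rfl
      simp only [mem_ofPred_eq, hc, hrk, coe_sub_le_coe_sub_iff hk]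
    rwa [hset] at h
  have hαlt : ∀ n, ENNReal.ofReal (a n) ≤ 1 := fun n => by simpa using (ha n).2.le
  have hα1 : Tendsto (fun n => ENNReal.ofReal (a n)) atTop (𝓝 1) := by
    simpa [Function.comp_def] using (ENNReal.continuous_ofReal.tendsto 1).comp hatend
  have hatend' : Tendsto a atTop (𝓝[Set.Ico (0 : ℝ) 1] 1) :=
    tendsto_nhdsWithin_iff.2 ⟨hatend, Eventually.of_forall ha⟩
  have hWseq : limsup (fun n => (1 - ENNReal.ofReal (a n)) * m (a n)) atTop ≤ W :=
    limsup_le_limsup_of_le (f := map a atTop) (u := fun α : ℝ => (1 - ENNReal.ofReal α) * m α)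
      hatend'
  obtain ⟨hum, φ, hφ, hle⟩ := exists_selector_average_inequality (M := M) hg hcomp hS2 hαlt hα1
    (fun n => hm _ (ha n)) (fun n x => iInf_le _ x) hW hWseq hu_top
  have hwBar : wBar M = (W : EReal) - k := wBar_eq hg hk hc
  refine ⟨φ, hφ, fun x => ?_, fun x => le_antisymm (le_iInf fun p => ?_) (iInf_le _ _)⟩
  · have hu_fun : uPointwise M a = fun x => ((liminf (fun n =>
        nnDiscOpt M g (ENNReal.ofReal (a n)) x - m (a n)) atTop : ℝ≥0∞) : EReal) := funext hu_eq
    have h := coe_sub_le_coe_sub_iff hk |>.2 (hle x)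
    rw [hwBar, hu_fun, eInt_coe _ hum, hc]
    rw [EReal.coe_ennreal_add, EReal.coe_ennreal_add] at h
    simpa only [sub_eq_add_neg, add_right_comm] using h
  · rw [avgCost_eq hg hk hc, avgCost_eq hg hk hc, coe_sub_le_coe_sub_iff hk]
    refine le_trans (limsup_inv_mul_le (hu_top x).ne fun N => ?_) limsup_iInf_nnDiscOpt_le
    have h := sum_detPolicy_le M (α := 1) (b := W) hg hum hφ
      (fun x => by simpa only [one_mul] using hle x) x N 0
    rw [lintegral_histMeas_zero M _ x hum] at h
    simpa only [one_pow, one_mul, zero_add, Finset.sum_const, Finset.card_range, nsmul_eq_mul]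
      using h

end Statements

end
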